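/- The function weak preserves the sequential order between messages that share a common lifeline: if a trace t is duplicate-free and two messages m and m' occur in t with m strictly before m' and m and m' share a common lifeline, then m occurs strictly before m' in every trace u ∈ weak(t). -/

import Mathlib

/-- A message `(s, l, r)`: sender lifeline `s`, label `l`, receiver lifeline `r`. -/
structure Message where
  s : String
  l : String
  r : String
deriving DecidableEq

/-- Two messages share a common lifeline if `{s, r}` of one meets `{s', r'}` of the other. -/
def Shares (m m' : Message) : Prop :=
  m.s = m'.s ∨ m.s = m'.r ∨ m.r = m'.s ∨ m.r = m'.r

instance (m m' : Message) : Decidable (Shares m m') := by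
  unfold Shares; infer_instance

/-- Weak sequential composition: the set of traces obtained from a trace by keeping the
order of messages sharing a common lifeline and interleaving the others. -/
def weak : List Message → Set (List Message)
  | [] => {[]}
  | [x] => {[x]}
  | x :: y :: t =>
    if Shares x y then
      (x :: ·) '' weak (y :: t)
    else
      (x :: ·) '' weak (y :: t) ∪ (y :: ·) '' weak (x :: t)
termination_by l => l.length

/-- Every trace in `weak t` is a permutation of `t`. -/
theorem perm_of_mem_weak (t : List Message) : ∀ u ∈ weak t, u.Perm t := by
  fun_induction weak t with
  | case1 => simp
  | case2 x => simp
  | case3 x y t h ih =>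
    rintro _ ⟨v, hv, rfl⟩
    exact (ih v hv).cons x
  | case4 x y t h ih₁ ih₂ =>
    rintro _ (⟨v, hv, rfl⟩ | ⟨v, hv, rfl⟩)
    · exact (ih₁ v hv).cons x
    · exact ((ih₂ v hv).cons y).trans (.swap x y t)

theorem pair_sublist_cons_iff {α : Type*} {a b c : α} {l : List α} :
    [a, b].Sublist (c :: l) ↔ [a, b].Sublist l ∨ a = c ∧ b ∈ l := by
  simp [List.sublist_cons_iff]

/-- Prepending the same message to both traces keeps the order of a pair preserved. -/
theorem pair_sublist_cons_of_mem_weak {x m m' : Message} {s v : List Message}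
    (hv : v ∈ weak s) (ih : [m, m'].Sublist s → [m, m'].Sublist v)
    (hb : [m, m'].Sublist (x :: s)) : [m, m'].Sublist (x :: v) := by
  rw [pair_sublist_cons_iff] at hb ⊢
  rw [(perm_of_mem_weak s v hv).mem_iff]
  exact hb.imp_left ih

/-- `weak` preserves the sequential order between messages that share a common lifeline:
if the trace `t` is duplicate-free, the messages `m` and `m'` share a common lifeline,
and `m` occurs strictly before `m'` in `t` (i.e. `[m, m']` is a sublist of `t`),
then `m` occurs strictly before `m'` in every trace of `weak t`. -/
theorem weak_preserves_lifeline_order (t : List Message) (hnd : t.Nodup)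
    (m m' : Message) (hsh : Shares m m') (hbefore : [m, m'].Sublist t) :
    ∀ u ∈ weak t, [m, m'].Sublist u := by
  clear hnd
  fun_induction weak t with
  | case1 => simp at hbefore
  | case2 x => simp at hbefore
  | case3 x y t h ih =>
    rintro _ ⟨v, hv, rfl⟩
    exact pair_sublist_cons_of_mem_weak hv (fun hb => ih hb v hv) hbefore
  | case4 x y t h ih₁ ih₂ =>
    rintro _ (⟨v, hv, rfl⟩ | ⟨v, hv, rfl⟩)
    · exact pair_sublist_cons_of_mem_weak hv (fun hb => ih₁ hb v hv) hbefore
    · refine pair_sublist_cons_of_mem_weak hv (fun hb => ih₂ hb v hv) ?_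
      simp only [pair_sublist_cons_iff, List.mem_cons] at hbefore ⊢
      grind
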